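/- Let α ∈ {1, −1}, where e_{−1} = e_{n−1}, he_{−1} = he_{n−1}, and −α denotes the other element of {1, −1}. Then for all x₁, x₂ ∈ sl₂(ℂ): (a) e_α(x₁) · e_{−α}(x₂) = he_{−α}(x₂) · he_α(x₁); (b) e_α(x₁) · he_α(x₂) = e_α(x₂) · he_α(x₁). -/

import Mathlib

open scoped BigOperators

/-- The algebra of `2 × 2` complex matrices. -/
abbrev M2 : Type := Matrix (Fin 2) (Fin 2) ℂ

/-- The diagonal matrix `D = diag(1, ω)`. -/
noncomputable def Dmat (ω : ℂ) : M2 := Matrix.diagonal ![1, ω]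

/-- The linear map `e_i : M₂(ℂ) → M₂(ℂ)`, `e_i(x) = (1/n) ∑_{j=0}^{n-1} ω^{-i j} D^j x D^{-j}`. -/
noncomputable def eM (n : ℕ) (ω : ℂ) (i : ℕ) (x : M2) : M2 :=
  (n : ℂ)⁻¹ • ∑ j ∈ Finset.range n, (ω ^ (i * j))⁻¹ • (Dmat ω ^ j * x * (Dmat ω ^ j)⁻¹)

/-- The matrix `H = e₁₂ + e₂₁`. -/
noncomputable def Hmat : M2 := !![0, 1; 1, 0]

/-- The map `he_i(x) = H ⬝ e_i(x) ⬝ H`. -/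
noncomputable def hem (n : ℕ) (ω : ℂ) (i : ℕ) (x : M2) : M2 := Hmat * eM n ω i x * Hmat

theorem Dmat_pow (ω : ℂ) (j : ℕ) : Dmat ω ^ j = Matrix.diagonal (![1, ω] ^ j) := by
  rw [Dmat, Matrix.diagonal_pow]

theorem Dmat_pow_inv {ω : ℂ} (hω : ω ≠ 0) (j : ℕ) :
    (Dmat ω ^ j)⁻¹ = Matrix.diagonal (![1, ω⁻¹] ^ j) := by
  refine Matrix.inv_eq_right_inv ?_
  rw [Dmat_pow, Matrix.diagonal_mul_diagonal, ← Matrix.diagonal_one]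
  congr 1
  ext a
  fin_cases a <;> simp [hω]

theorem eM_apply {ω : ℂ} (hω : ω ≠ 0) (n i : ℕ) (x : M2) (a b : Fin 2) :
    eM n ω i x a b = (n : ℂ)⁻¹ *
      ((∑ j ∈ Finset.range n, ((ω ^ i)⁻¹ * (![1, ω] a * ![1, ω⁻¹] b)) ^ j) * x a b) := by
  simp only [eM, Dmat_pow_inv hω]
  simp only [Dmat_pow, Matrix.smul_apply, Matrix.sum_apply, smul_eq_mul,
    Matrix.mul_diagonal, Matrix.diagonal_mul, Finset.sum_mul, Pi.pow_apply]
  congr 1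
  refine Finset.sum_congr rfl fun j _ => ?_
  rw [mul_pow, mul_pow, inv_pow, ← pow_mul]
  ring

theorem sum_range_pow_eq_zero {z : ℂ} {n : ℕ} (hz : z ^ n = 1) (h : z ≠ 1) :
    ∑ j ∈ Finset.range n, z ^ j = 0 := by
  rw [geom_sum_eq h, hz, sub_self, zero_div]

theorem sum_range_inv_pow_eq_zero {n : ℕ} {ω : ℂ} (hω : IsPrimitiveRoot ω n) {k : ℕ}
    (hk : ¬ n ∣ k) : ∑ j ∈ Finset.range n, ((ω ^ k)⁻¹) ^ j = 0 := by
  refine sum_range_pow_eq_zero ?_ ?_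
  · rw [inv_pow, ← pow_mul, mul_comm, pow_mul, hω.pow_eq_one, one_pow, inv_one]
  · rwa [Ne, inv_eq_one, hω.pow_eq_one_iff_dvd]

/-- The diagonal entries of `e_i(x)` vanish unless `n ∣ i`. -/
theorem eM_apply_self {n : ℕ} (hn : n ≠ 0) {ω : ℂ} (hω : IsPrimitiveRoot ω n) {i : ℕ}
    (hi : ¬ n ∣ i) (x : M2) (a : Fin 2) : eM n ω i x a a = 0 := by
  have h0 := hω.ne_zero hn
  have h : (ω ^ i)⁻¹ * (![1, ω] a * ![1, ω⁻¹] a) = (ω ^ i)⁻¹ := by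
    fin_cases a <;> simp [h0]
  rw [eM_apply h0, h, sum_range_inv_pow_eq_zero hω hi, zero_mul, mul_zero]

theorem eM_apply_zero_one {n : ℕ} (hn : n ≠ 0) {ω : ℂ} (hω : IsPrimitiveRoot ω n) {i : ℕ}
    (hi : ¬ n ∣ i + 1) (x : M2) : eM n ω i x 0 1 = 0 := by
  have h0 := hω.ne_zero hn
  have h : (ω ^ i)⁻¹ * (![1, ω] 0 * ![1, ω⁻¹] 1) = (ω ^ (i + 1))⁻¹ := by
    simp [pow_succ, mul_comm]
  rw [eM_apply h0, h, sum_range_inv_pow_eq_zero hω hi, zero_mul, mul_zero]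

theorem eM_succ_apply_one_zero {n : ℕ} (hn : n ≠ 0) {ω : ℂ} (hω : IsPrimitiveRoot ω n) {i : ℕ}
    (hi : ¬ n ∣ i) (x : M2) : eM n ω (i + 1) x 1 0 = 0 := by
  have h0 := hω.ne_zero hn
  have h : (ω ^ (i + 1))⁻¹ * (![1, ω] 1 * ![1, ω⁻¹] 0) = (ω ^ i)⁻¹ := by
    simp [pow_succ, h0, mul_comm]
  rw [eM_apply h0, h, sum_range_inv_pow_eq_zero hω hi, zero_mul, mul_zero]

theorem eM_one_eq {n : ℕ} (hn : 3 ≤ n) {ω : ℂ} (hω : IsPrimitiveRoot ω n) (x : M2) :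
    eM n ω 1 x = !![0, 0; eM n ω 1 x 1 0, 0] := by
  have h1 : ¬ n ∣ 1 := Nat.not_dvd_of_pos_of_lt one_pos (by omega)
  have h2 : ¬ n ∣ 1 + 1 := Nat.not_dvd_of_pos_of_lt two_pos (by omega)
  ext a b
  fin_cases a <;> fin_cases b <;>
    simp [eM_apply_self (by omega) hω h1, eM_apply_zero_one (by omega) hω h2]

theorem eM_sub_one_eq {n : ℕ} (hn : 3 ≤ n) {ω : ℂ} (hω : IsPrimitiveRoot ω n) (x : M2) :
    eM n ω (n - 1) x = !![0, eM n ω (n - 1) x 0 1; 0, 0] := by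
  have h1 : ¬ n ∣ n - 1 := Nat.not_dvd_of_pos_of_lt (by omega) (by omega)
  have h2 : ¬ n ∣ n - 2 := Nat.not_dvd_of_pos_of_lt (by omega) (by omega)
  have h3 : eM n ω (n - 1) x 1 0 = 0 := by
    rw [show n - 1 = n - 2 + 1 by omega]
    exact eM_succ_apply_one_zero (by omega) hω h2 x
  ext a b
  fin_cases a <;> fin_cases b <;> simp [eM_apply_self (by omega) hω h1, h3]

/-- Let `α ∈ {1, -1}` (with `e_{-1} = e_{n-1}`, `he_{-1} = he_{n-1}`, and `-α` (denoted `β`) the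
other element of `{1, -1}`). Then for all `x₁, x₂ ∈ sl₂(ℂ)`:
(a) `e_α(x₁) e_{-α}(x₂) = he_{-α}(x₂) he_α(x₁)`;
(b) `e_α(x₁) he_α(x₂) = e_α(x₂) he_α(x₁)`. -/
theorem exchange_identities (n : ℕ) (hn : 3 ≤ n) (ω : ℂ) (hω : IsPrimitiveRoot ω n)
    (α β : ℕ) (hαβ : (α = 1 ∧ β = n - 1) ∨ (α = n - 1 ∧ β = 1))
    (x₁ x₂ : M2) (hx₁ : Matrix.trace x₁ = 0) (hx₂ : Matrix.trace x₂ = 0) :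
    eM n ω α x₁ * eM n ω β x₂ = hem n ω β x₂ * hem n ω α x₁ ∧
    eM n ω α x₁ * hem n ω α x₂ = eM n ω α x₂ * hem n ω α x₁ := by
  have h (x : M2) := eM_one_eq hn hω x
  have h' (x : M2) := eM_sub_one_eq hn hω x
  simp only [hem]
  rcases hαβ with ⟨rfl, rfl⟩ | ⟨rfl, rfl⟩
  · rw [h x₁, h x₂, h' x₂]
    simp [Hmat, mul_comm]
  · rw [h' x₁, h' x₂, h x₂]
    simp [Hmat, mul_comm]
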